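/- arXiv:1409.8223 — 2 statements merged into one kernel-verified Lean document; each statement's English description precedes it below -/
import Mathlib

section
/- Let n ≥ 1 and k ∈ ℕ, and let f : ℝ^n → ℝ be a k-regulous function with representation f = p/q on {x : q(x) ≠ 0}, where p, q are real polynomials in n variables and q ≠ 0 as a polynomial. Then for every l ∈ ℕ and every integer t ≥ 1, the function x ↦ p(x)^l · f(x)^t is of class C^{k+l} on ℝ^n (and hence is (k+l)-regulous). -/
open MvPolynomial

theorem aux_line {n : ℕ} (q : MvPolynomial (Fin n) ℝ) (x y : Fin n → ℝ) (hy : eval y q ≠ 0) :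
    {s : ℝ | eval (y + s • (x - y)) q = 0}.Finite := by
  set r : Polynomial ℝ :=
    aeval (fun i => Polynomial.C (y i) + Polynomial.X * Polynomial.C (x i - y i)) q with hr
  have key : ∀ s, Polynomial.eval s r = eval (y + s • (x - y)) q := by
    intro s
    have : (Polynomial.aeval s : Polynomial ℝ →ₐ[ℝ] ℝ).comp
      (aeval (fun i => Polynomial.C (y i) + Polynomial.X * Polynomial.C (x i - y i))) =
      aeval (y + s • (x - y)) := by
      ext i
      simp
    simpa [hr] using congrArg (fun φ => φ q) this
  have hr0 : r ≠ 0 := by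
    intro h
    have := key 0
    rw [h] at this
    simp at this
    exact hy this.symm
  refine (Polynomial.finite_setOfPred_isRoot hr0).subset ?_
  intro s hs
  simp only [Set.mem_ofPred_eq, Polynomial.IsRoot.def] at hs ⊢
  rw [key, hs]

theorem aux_dense {n : ℕ} (q : MvPolynomial (Fin n) ℝ) (hq : q ≠ 0) :
    Dense {x : Fin n → ℝ | eval x q ≠ 0} := by
  obtain ⟨y, hy⟩ : ∃ y : Fin n → ℝ, eval y q ≠ 0 := by
    by_contra! h
    exact hq (MvPolynomial.funext (fun x => by simpa using h x))
  intro x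
  have hd : Dense {s : ℝ | eval (y + s • (x - y)) q = 0}ᶜ :=
    (aux_line q x y hy).countable.dense_compl ℝ
  have hc : Continuous (fun s : ℝ => y + s • (x - y)) := by fun_prop
  have h1 := hd 1
  have := map_mem_closure hc h1 (t := {x : Fin n → ℝ | eval x q ≠ 0}) (fun s hs => hs)
  simpa using this

theorem aux_deriv {n : ℕ} (q : MvPolynomial (Fin n) ℝ) (hq : q ≠ 0)
    (g : (Fin n → ℝ) → ℝ) (D : (Fin n → ℝ) → ((Fin n → ℝ) →L[ℝ] ℝ))
    (hg : Continuous g) (hD : Continuous D)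
    (h : ∀ x, eval x q ≠ 0 → HasFDerivAt g (D x) x) (x : Fin n → ℝ) :
    HasFDerivAt g (D x) x := by
  rw [hasFDerivAt_iff_isLittleO, Asymptotics.isLittleO_iff]
  intro ε hε
  obtain ⟨δ, hδ, hball⟩ := Metric.continuous_iff.1 hD x ε hε
  filter_upwards [Metric.ball_mem_nhds x hδ] with z hz
  -- generic points
  have gen : ∀ y ∈ Metric.ball x δ, eval y q ≠ 0 → ‖g y - g x - D x (y - x)‖ ≤ ε * ‖y - x‖ := by
    intro y hy hyq
    have hfin := aux_line q x y hyq
    have hcl : Continuous (fun s : ℝ => y + s • (x - y)) := by fun_prop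
    have hint := MeasureTheory.integral_eq_of_hasDerivAt_off_countable
      (a := (0:ℝ)) (b := 1)
      (fun s : ℝ => g (y + s • (x - y)) - s * D x (x - y))
      (fun s : ℝ => D (y + s • (x - y)) (x - y) - D x (x - y))
      hfin.countable
      (by fun_prop)
      (by
        intro s hs
        have h1 := h _ hs.2
        have h2 : HasDerivAt (fun s : ℝ => y + s • (x - y)) (x - y) s := by
          simpa using ((hasDerivAt_id s).smul_const (x - y)).const_add y
        have h3 := h1.comp_hasDerivAt s h2
        have h4 := (hasDerivAt_id s).mul_const (D x (x - y))
        rw [one_mul] at h4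
        exact h3.sub h4)
      (by
        apply Continuous.intervalIntegrable
        fun_prop)
    have hb := intervalIntegral.norm_integral_le_of_norm_le_const (a := (0:ℝ)) (b := 1)
      (f := fun s : ℝ => D (y + s • (x - y)) (x - y) - D x (x - y)) (C := ε * ‖x - y‖) (by
        intro s hs
        rw [Set.uIoc_of_le zero_le_one] at hs
        have hmem : y + s • (x - y) ∈ Metric.ball x δ :=
          (convex_ball x δ).add_smul_sub_mem hy (Metric.mem_ball_self hδ) ⟨hs.1.le, hs.2⟩
        have := hball _ hmem
        rw [dist_eq_norm] at this
        rw [← sub_apply]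
        exact (ContinuousLinearMap.le_opNorm _ _).trans (by gcongr))
    rw [hint] at hb
    rw [← norm_neg, norm_sub_rev y x]
    have e1 : -(g y - g x - D x (y - x)) = g (y + (1 : ℝ) • (x - y)) - 1 * D x (x - y)
        - (g (y + (0 : ℝ) • (x - y)) - 0 * D x (x - y)) := by
      simp
      ring
    have e2 : ε * ‖x - y‖ = ε * ‖x - y‖ * |(1 : ℝ) - 0| := by simp
    rw [e1, e2]
    exact hb
  have hcl : IsClosed {y | ‖g y - g x - D x (y - x)‖ ≤ ε * ‖y - x‖} :=
    isClosed_le (by fun_prop) (by fun_prop)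
  have hmem : z ∈ closure (Metric.ball x δ ∩ {x : Fin n → ℝ | eval x q ≠ 0}) :=
    (aux_dense q hq).open_subset_closure_inter Metric.isOpen_ball hz
  exact closure_minimal (fun y hy => gen y hy.1 hy.2) hcl hmem

theorem aux_contDiff {n : ℕ} (q : MvPolynomial (Fin n) ℝ) (m : WithTop ℕ∞) :
    ContDiff ℝ m (fun x : Fin n → ℝ => eval x q) := by
  induction q using MvPolynomial.induction_on with
  | C a => simpa using contDiff_const
  | add p q hp hq => simpa using hp.add hq
  | mul_X p i hp => simpa using hp.mul (contDiff_apply ℝ ℝ i)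

/-- STATEMENT 13: if `f` is `k`-regulous with representation `p/q`, then `p^l · f^t` is of
class `C^{k+l}` on `ℝ^n` for every `l ∈ ℕ` and every `t ≥ 1`. -/
theorem pow_num_mul_pow_regulous_contDiff
    (n k : ℕ) (hn : 1 ≤ n)
    (f : (Fin n → ℝ) → ℝ) (hfc : Continuous f) (hfk : ContDiff ℝ k f)
    (p q : MvPolynomial (Fin n) ℝ) (hq : q ≠ 0)
    (hrep : ∀ x : Fin n → ℝ, eval x q ≠ 0 → f x = eval x p / eval x q)
    (l t : ℕ) (ht : 1 ≤ t) :
    ContDiff ℝ (k + l : ℕ) (fun x => eval x p ^ l * f x ^ t) := by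
  induction l generalizing t with
  | zero => simpa using hfk.pow t
  | succ l ih =>
    have hp1 := aux_contDiff p ((k + l : ℕ) + 1 : WithTop ℕ∞)
    have hq1 := aux_contDiff q ((k + l : ℕ) + 1 : WithTop ℕ∞)
    have hp' : ContDiff ℝ (k + l : ℕ) (fderiv ℝ (fun x : Fin n → ℝ => eval x p)) :=
      hp1.fderiv_right le_rfl
    have hq' : ContDiff ℝ (k + l : ℕ) (fderiv ℝ (fun x : Fin n → ℝ => eval x q)) :=
      hq1.fderiv_right le_rfl
    set D : (Fin n → ℝ) → ((Fin n → ℝ) →L[ℝ] ℝ) := fun x =>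
      (((l + 1 + t : ℕ) : ℝ) * (eval x p ^ l * f x ^ t)) • fderiv ℝ (fun x => eval x p) x
      - ((t : ℝ) * (eval x p ^ l * f x ^ (t + 1))) • fderiv ℝ (fun x => eval x q) x with hDdef
    have hD : ContDiff ℝ (k + l : ℕ) D :=
      ((contDiff_const.mul (ih t ht)).smul hp').sub
        ((contDiff_const.mul (ih (t + 1) (by omega))).smul hq')
    have hpc : Continuous (fun x : Fin n → ℝ => eval x p) := hp1.continuous
    have hqc : Continuous (fun x : Fin n → ℝ => eval x q) := hq1.continuous
    have hder : ∀ x, HasFDerivAt (fun x => eval x p ^ (l + 1) * f x ^ t) (D x) x := by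
      apply aux_deriv q hq _ D ((hpc.pow _).mul (hfc.pow _)) hD.continuous
      intro x hx
      have hpd : HasFDerivAt (fun x : Fin n → ℝ => eval x p) _ x :=
        ((aux_contDiff p 1).differentiable one_ne_zero x).hasFDerivAt
      have hqd : HasFDerivAt (fun x : Fin n → ℝ => eval x q) _ x :=
        ((aux_contDiff q 1).differentiable one_ne_zero x).hasFDerivAt
      have hev : (fun x => eval x p ^ (l + 1) * f x ^ t) =ᶠ[nhds x]
          fun x => eval x p ^ (l + 1 + t) * ((eval x q) ^ t)⁻¹ := by
        filter_upwards [hqc.continuousAt.eventually_ne hx] with z hz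
        rw [hrep z hz, div_pow, pow_add _ (l + 1) t, div_eq_mul_inv, mul_assoc]
      refine HasFDerivAt.congr_of_eventuallyEq ?_ hev
      have h1 := hpd.pow (l + 1 + t)
      have h2 := (hasDerivAt_inv (pow_ne_zero t hx)).comp_hasFDerivAt x (hqd.pow t)
      refine (h1.mul h2).congr_fderiv ?_
      obtain ⟨t, rfl⟩ : ∃ s, t = s + 1 := ⟨t - 1, by omega⟩
      ext v
      simp [hDdef, hrep x hx, div_pow]
      generalize eval x q = b at hx ⊢
      generalize eval x p = a
      field_simp
      ring
    have : ((k + (l + 1) : ℕ) : WithTop ℕ∞) = (k + l : ℕ) + 1 := by push_cast; ring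
    rw [this, contDiff_succ_iff_hasFDerivAt]
    exact ⟨D, hD, hder⟩
end

section
/- Let k ∈ ℕ and let f ∈ R^{k+1}_{[1]}(ℝ²), i.e., f is [1]-regulous and of class C^{k+1} on ℝ². Then for every vector v ∈ ℝ², the directional derivative function x ↦ (fderiv ℝ f x) v belongs to R^k_{[1]}(ℝ²), i.e., it is [1]-regulous and of class C^k on ℝ². -/
open MvPolynomial

/-- The polynomial `y ↦ q(a + y)`. -/
noncomputable def shiftPoly (a : Fin 2 → ℝ) (q : MvPolynomial (Fin 2) ℝ) :
    MvPolynomial (Fin 2) ℝ :=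
  bind₁ (fun i => C (a i) + X i) q

/-- The lowest-degree nonzero homogeneous component of `y ↦ q(a + y)` is positive
definite: it takes positive values at every `y ≠ 0`. -/
def LocPosDef (q : MvPolynomial (Fin 2) ℝ) (a : Fin 2 → ℝ) : Prop :=
  ∃ m : ℕ, homogeneousComponent m (shiftPoly a q) ≠ 0 ∧
    (∀ d < m, homogeneousComponent d (shiftPoly a q) = 0) ∧
    ∀ y : Fin 2 → ℝ, y ≠ 0 → 0 < eval y (homogeneousComponent m (shiftPoly a q))

/-- `p, q` is a representation of `f` witnessing that `f` is [1]-regulous: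
`p` and `q` are relatively prime, `q ≥ 0` on `ℝ²` with finite zero set, `f = p/q` off
`Z(q)`, and at every point of `Z(q)` the lowest-degree homogeneous component of `q` is
positive definite. -/
def OneRegulousRep (f : (Fin 2 → ℝ) → ℝ) (p q : MvPolynomial (Fin 2) ℝ) : Prop :=
  IsRelPrime p q ∧ (∀ x : Fin 2 → ℝ, 0 ≤ eval x q) ∧
    {x : Fin 2 → ℝ | eval x q = 0}.Finite ∧
    (∀ x : Fin 2 → ℝ, eval x q ≠ 0 → f x = eval x p / eval x q) ∧
    ∀ a : Fin 2 → ℝ, eval a q = 0 → LocPosDef q a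

/-- `f : ℝ² → ℝ` is [1]-regulous: continuous, and a rational function which becomes
regular after one stage of blowings-up of points. -/
def OneRegulous (f : (Fin 2 → ℝ) → ℝ) : Prop :=
  Continuous f ∧ ∃ p q : MvPolynomial (Fin 2) ℝ, OneRegulousRep f p q

theorem coeff_eq_zero_of_low {S : MvPolynomial (Fin 2) ℝ} {m : ℕ}
    (hS : ∀ d < m, homogeneousComponent d S = 0) (x : Fin 2 →₀ ℕ) (hx : x.degree < m) :
    coeff x S = 0 := by
  have h := congrArg (coeff x) (hS _ hx)
  rwa [coeff_homogeneousComponent, if_pos rfl, coeff_zero] at h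

theorem hc_mul_low {S T : MvPolynomial (Fin 2) ℝ} {m n : ℕ}
    (hS : ∀ d < m, homogeneousComponent d S = 0)
    (hT : ∀ d < n, homogeneousComponent d T = 0) :
    (∀ d < m + n, homogeneousComponent d (S * T) = 0) ∧
    homogeneousComponent (m + n) (S * T) =
      homogeneousComponent m S * homogeneousComponent n T := by
  have cS := coeff_eq_zero_of_low hS
  have cT := coeff_eq_zero_of_low hT
  constructor
  · intro d hd
    ext e
    rw [coeff_homogeneousComponent, coeff_zero]
    split_ifs with he
    · rw [coeff_mul]
      refine Finset.sum_eq_zero fun z hz => ?_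
      have hz' := congrArg Finsupp.degree (Finset.HasAntidiagonal.mem_antidiagonal.1 hz)
      rw [map_add] at hz'
      by_cases h1 : z.1.degree < m
      · rw [cS _ h1, zero_mul]
      · rw [cT _ (by omega), mul_zero]
    · rfl
  · ext e
    by_cases he : e.degree = m + n
    · rw [coeff_homogeneousComponent, if_pos he, coeff_mul, coeff_mul]
      refine Finset.sum_congr rfl fun z hz => ?_
      have hz' := congrArg Finsupp.degree (Finset.HasAntidiagonal.mem_antidiagonal.1 hz)
      rw [map_add] at hz'
      rw [coeff_homogeneousComponent, coeff_homogeneousComponent]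
      by_cases h1 : z.1.degree < m
      · rw [cS _ h1]; simp
      · by_cases h2 : z.2.degree < n
        · rw [cT _ h2]; simp
        · rw [if_pos (by omega), if_pos (by omega)]
    · rw [coeff_homogeneousComponent, if_neg he]
      have := (homogeneousComponent_isHomogeneous m S).mul (homogeneousComponent_isHomogeneous n T)
      symm
      exact this.coeff_eq_zero he

theorem low_unique {S : MvPolynomial (Fin 2) ℝ} {m n : ℕ}
    (hm : ∀ d < m, homogeneousComponent d S = 0) (hm' : homogeneousComponent m S ≠ 0)
    (hn : ∀ d < n, homogeneousComponent d S = 0) (hn' : homogeneousComponent n S ≠ 0) :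
    m = n := by
  rcases lt_trichotomy m n with h | h | h
  · exact absurd (hn _ h) hm'
  · exact h
  · exact absurd (hm _ h) hn'

theorem exists_low {S : MvPolynomial (Fin 2) ℝ} (hS : S ≠ 0) :
    ∃ m, homogeneousComponent m S ≠ 0 ∧ ∀ d < m, homogeneousComponent d S = 0 := by
  classical
  have h : ∃ m, homogeneousComponent m S ≠ 0 := by
    by_contra! h
    apply hS
    rw [← sum_homogeneousComponent S]
    exact Finset.sum_eq_zero fun i _ => h i
  exact ⟨Nat.find h, Nat.find_spec h, fun d hd => not_not.1 (Nat.find_min h hd)⟩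

theorem eval_smul_hom {S : MvPolynomial (Fin 2) ℝ} {n : ℕ} (hS : S.IsHomogeneous n)
    (t : ℝ) (y : Fin 2 → ℝ) : eval (t • y) S = t ^ n * eval y S := by
  rw [eval_eq, eval_eq, Finset.mul_sum]
  refine Finset.sum_congr rfl fun d hd => ?_
  have h := hS.degree_eq_sum_deg_support hd
  simp only [Pi.smul_apply, smul_eq_mul, mul_pow, Finset.prod_mul_distrib]
  rw [Finset.prod_pow_eq_pow_sum]
  rw [h]
  ring

theorem eval_low_nonneg {S : MvPolynomial (Fin 2) ℝ} (hS : ∀ x, 0 ≤ eval x S) {m : ℕ}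
    (hm : ∀ d < m, homogeneousComponent d S = 0) (y : Fin 2 → ℝ) :
    0 ≤ eval y (homogeneousComponent m S) := by
  set c : ℕ → ℝ := fun d => eval y (homogeneousComponent d S) with hc
  have c0 : ∀ d < m, c d = 0 := fun d hd => by simp [hc, hm d hd]
  set D := S.totalDegree + 1
  by_cases hmD : m < D
  swap
  · rw [homogeneousComponent_eq_zero m S (by omega)]; simp
  have hsum : ∀ t : ℝ, eval (t • y) S = ∑ d ∈ Finset.range D, t ^ d * c d := by
    intro t
    conv_lhs => rw [← sum_homogeneousComponent S]
    rw [map_sum]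
    exact Finset.sum_congr rfl fun d _ =>
      eval_smul_hom (homogeneousComponent_isHomogeneous d S) t y
  set G : ℝ → ℝ := fun t => ∑ d ∈ Finset.range D, t ^ (d - m) * c d with hG
  have hGc : Continuous G := by fun_prop
  have hG0 : G 0 = c m := by
    simp only [hG]
    rw [Finset.sum_eq_single m]
    · simp
    · intro d _ hd
      rcases lt_or_gt_of_ne hd with h | h
      · rw [c0 d h, mul_zero]
      · rw [zero_pow (by omega), zero_mul]
    · intro h; exact absurd (Finset.mem_range.2 hmD) h
  have hmul : ∀ t, t ^ m * G t = eval (t • y) S := by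
    intro t
    rw [hsum, Finset.mul_sum]
    refine Finset.sum_congr rfl fun d _ => ?_
    by_cases h : d < m
    · simp [c0 d h]
    · rw [← mul_assoc, ← pow_add, Nat.add_sub_cancel' (by omega)]
  have hpos : ∀ t ∈ Set.Ioi (0:ℝ), 0 ≤ G t := by
    intro t ht
    have h := hS (t • y)
    rw [← hmul] at h
    exact nonneg_of_mul_nonneg_right h (pow_pos ht m)
  have h0 : (0:ℝ) ∈ closure (Set.Ioi (0:ℝ)) := by simp
  have := closure_minimal (s := Set.Ioi (0:ℝ)) (t := {t | 0 ≤ G t}) hpos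
    (isClosed_le continuous_const hGc) h0
  change 0 ≤ c m
  rw [← hG0]
  exact this

theorem shiftPoly_mul (a : Fin 2 → ℝ) (p q : MvPolynomial (Fin 2) ℝ) :
    shiftPoly a (p * q) = shiftPoly a p * shiftPoly a q := by
  simp [shiftPoly]

theorem eval_shiftPoly (a x : Fin 2 → ℝ) (q : MvPolynomial (Fin 2) ℝ) :
    eval x (shiftPoly a q) = eval (a + x) q := by
  induction q using MvPolynomial.induction_on with
  | C r => simp [shiftPoly]
  | add p q hp hq => simp [shiftPoly] at *; rw [hp, hq]
  | mul_X p i hp => rw [shiftPoly_mul, map_mul, hp]; simp [shiftPoly]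

theorem locPosDef_of_factor {q c Q : MvPolynomial (Fin 2) ℝ} (h : c * Q = q * q)
    (hQ : ∀ x, 0 ≤ eval x Q) (a : Fin 2 → ℝ) (hq : LocPosDef q a) : LocPosDef Q a := by
  obtain ⟨m, hm0, hml, hmp⟩ := hq
  have hsh : shiftPoly a c * shiftPoly a Q = shiftPoly a q * shiftPoly a q := by
    rw [← shiftPoly_mul, h, shiftPoly_mul]
  have hne : shiftPoly a q ≠ 0 := by
    intro h0; rw [h0] at hm0; simp at hm0
  have hne2 := mul_ne_zero hne hne
  rw [← hsh] at hne2
  obtain ⟨i, hi, hil⟩ := exists_low (left_ne_zero_of_mul hne2)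
  obtain ⟨j, hj, hjl⟩ := exists_low (right_ne_zero_of_mul hne2)
  obtain ⟨hA, hB⟩ := hc_mul_low hil hjl
  obtain ⟨hA', hB'⟩ := hc_mul_low hml hml
  rw [← hsh] at hA' hB'
  have hij : i + j = m + m := low_unique hA (by rw [hB]; exact mul_ne_zero hi hj) hA'
    (by rw [hB']; exact mul_ne_zero hm0 hm0)
  rw [← hij, hB] at hB'
  refine ⟨j, hj, hjl, fun y hy => ?_⟩
  have h1 : 0 ≤ eval y (homogeneousComponent j (shiftPoly a Q)) :=
    eval_low_nonneg (fun x => by rw [eval_shiftPoly]; exact hQ _) hjl y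
  refine lt_of_le_of_ne h1 fun h2 => ?_
  have h3 := congrArg (eval y) hB'
  rw [map_mul, map_mul, ← h2, mul_zero] at h3
  have := mul_pos (hmp y hy) (hmp y hy)
  linarith

theorem exists_deriv_poly (v : Fin 2 → ℝ) (p : MvPolynomial (Fin 2) ℝ) :
    ∃ p' : MvPolynomial (Fin 2) ℝ, ∀ x : Fin 2 → ℝ,
      DifferentiableAt ℝ (fun x => eval x p) x ∧
      fderiv ℝ (fun x => eval x p) x v = eval x p' := by
  induction p using MvPolynomial.induction_on with
  | C r => exact ⟨0, fun x => by simp⟩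
  | add p q hp hq =>
    obtain ⟨p', hp⟩ := hp
    obtain ⟨q', hq⟩ := hq
    refine ⟨p' + q', fun x => ?_⟩
    simp only [map_add]
    refine ⟨(hp x).1.add (hq x).1, ?_⟩
    rw [fderiv_fun_add (hp x).1 (hq x).1, add_apply, (hp x).2, (hq x).2]
  | mul_X p i hp =>
    obtain ⟨p', hp⟩ := hp
    refine ⟨p * C (v i) + X i * p', fun x => ?_⟩
    have hd : HasFDerivAt (fun x : Fin 2 → ℝ => x i)
      (ContinuousLinearMap.proj (R := ℝ) (φ := fun _ : Fin 2 => ℝ) i) x :=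
      (ContinuousLinearMap.proj (R := ℝ) (φ := fun _ : Fin 2 => ℝ) i).hasFDerivAt
    have hh := (hp x).1.hasFDerivAt.fun_mul hd
    simp only [map_mul, eval_X, map_add, eval_C]
    refine ⟨hh.differentiableAt, ?_⟩
    rw [HasFDerivAt.fderiv hh]
    simp [(hp x).2]

theorem exists_signed {Q : MvPolynomial (Fin 2) ℝ}
    (hf : {x : Fin 2 → ℝ | eval x Q = 0}.Finite) :
    (∀ x, 0 ≤ eval x Q) ∨ (∀ x, 0 ≤ eval x (-Q)) := by
  have hconn : IsConnected ({x : Fin 2 → ℝ | eval x Q = 0}ᶜ) :=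
    hf.countable.isConnected_compl_of_one_lt_rank (by simp)
  have hc : Continuous fun x => eval x Q := MvPolynomial.continuous_eval Q
  by_contra! h
  obtain ⟨⟨x, hx⟩, ⟨y, hy⟩⟩ := h
  rw [map_neg] at hy
  have := hconn.isPreconnected.intermediate_value (a := x) (b := y) (f := fun x => eval x Q)
    (by simp [hx.ne]) (by simp; intro h; rw [h] at hy; simp at hy) hc.continuousOn
  obtain ⟨z, hz, hz0⟩ := this (show (0:ℝ) ∈ Set.Icc (eval x Q) (eval y Q) from
    ⟨hx.le, by linarith⟩)
  exact hz hz0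

/-- STATEMENT 18: if `f ∈ R^{k+1}_{[1]}(ℝ²)` then every directional derivative of `f`
belongs to `R^k_{[1]}(ℝ²)`. -/
theorem directional_derivative_mem_Rk1
    (k : ℕ) (f : (Fin 2 → ℝ) → ℝ)
    (hf : OneRegulous f) (hfk : ContDiff ℝ (k + 1 : ℕ) f) (v : Fin 2 → ℝ) :
    OneRegulous (fun x => fderiv ℝ f x v) ∧ ContDiff ℝ k (fun x => fderiv ℝ f x v) := by
  have hk : ContDiff ℝ k (fun x => fderiv ℝ f x v) := by
    have h1 : ContDiff ℝ k (fderiv ℝ f) := hfk.fderiv_right (by norm_cast)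
    exact h1.clm_apply contDiff_const
  refine ⟨⟨hk.continuous, ?_⟩, hk⟩
  obtain ⟨hfc, p, q, hrel, hq0, hqf, hfe, hql⟩ := hf
  obtain ⟨p', hp'⟩ := exists_deriv_poly v p
  obtain ⟨q', hq'⟩ := exists_deriv_poly v q
  have hder : ∀ x, eval x q ≠ 0 →
      fderiv ℝ f x v * eval x (q * q) = eval x (q * p' - p * q') := by
    intro x hx
    have hqc : Continuous fun x => eval x q := MvPolynomial.continuous_eval q
    have hev : (fun z => f z * eval z q) =ᶠ[nhds x] fun z => eval z p := by
      filter_upwards [hqc.continuousAt.eventually_ne hx] with z hz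
      rw [hfe z hz, div_mul_cancel₀ _ hz]
    have hfd : DifferentiableAt ℝ f x := hfk.differentiable (by simp) x
    have h1 := hev.fderiv_eq (𝕜 := ℝ)
    have h2 := (hfd.hasFDerivAt.fun_mul (hq' x).1.hasFDerivAt).fderiv
    have h3 := congrArg (fun L => L v) (h2.symm.trans h1)
    simp only [ContinuousLinearMap.add_apply, ContinuousLinearMap.smul_apply, smul_eq_mul,
      (hp' x).2, (hq' x).2] at h3
    rw [hfe x hx] at h3
    field_simp at h3
    simp only [map_sub, map_mul]
    linarith
  have hqne : q ≠ 0 := by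
    rintro rfl
    simp at hqf
    exact Set.infinite_univ hqf
  obtain ⟨P, Q, c, hPQ, hP, hQ⟩ := UniqueFactorizationMonoid.exists_reduced_factors'
    (q * p' - p * q') (q * q) (mul_ne_zero hqne hqne)
  have key : ∀ P Q c : MvPolynomial (Fin 2) ℝ, IsRelPrime P Q → c * P = q * p' - p * q' →
      c * Q = q * q → (∀ x, 0 ≤ eval x Q) → OneRegulousRep (fun x => fderiv ℝ f x v) P Q := by
    intro P Q c hPQ hP hQ hQ0
    have hz : ∀ x, eval x Q = 0 → eval x q = 0 := by
      intro x hx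
      have := congrArg (eval x) hQ
      rw [map_mul, map_mul, hx, mul_zero] at this
      exact mul_self_eq_zero.1 this.symm
    refine ⟨hPQ, hQ0, hqf.subset hz, ?_, fun a ha => locPosDef_of_factor hQ hQ0 a (hql a (hz a ha))⟩
    have heq : (fun x => fderiv ℝ f x v * eval x Q) = fun x => eval x P := by
      refine Continuous.ext_on (hqf.countable.dense_compl ℝ)
        (hk.continuous.mul (MvPolynomial.continuous_eval Q)) (MvPolynomial.continuous_eval P) ?_
      intro x hx
      have hx' : eval x q ≠ 0 := hx
      have h1 := hder x hx'
      have hcx : eval x c ≠ 0 := by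
        intro h0
        have := congrArg (eval x) hQ
        rw [map_mul, map_mul, h0, zero_mul] at this
        exact hx' (mul_self_eq_zero.1 this.symm)
      rw [← hQ, ← hP, map_mul, map_mul] at h1
      refine mul_left_cancel₀ hcx ?_
      simp only
      linarith
    intro x hx
    rw [eq_div_iff hx]
    exact congrFun heq x
  have hz : ∀ x, eval x Q = 0 → eval x q = 0 := by
    intro x hx
    have := congrArg (eval x) hQ
    rw [map_mul, map_mul, hx, mul_zero] at this
    exact mul_self_eq_zero.1 this.symm
  rcases exists_signed (hqf.subset hz) with h | h
  · exact ⟨P, Q, key P Q c hPQ hP hQ h⟩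
  · exact ⟨-P, -Q, key (-P) (-Q) (-c) hPQ.neg_neg (by rw [neg_mul_neg, hP])
      (by rw [neg_mul_neg, hQ]) h⟩
end
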